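/- arXiv:2103.04311 — 11 statements merged into one kernel-verified Lean document; each statement's English description precedes it below -/
import Mathlib

section
/- Let G be a finite simple graph in which every vertex has degree at least 2, let m be the total number of darts of G (so m = Σ_x deg(x)), and let l ≥ 1 be a natural number. Let M_l denote the number of non-backtracking walks of length l in G. Then M_l^m ≥ m^m · (∏_{e dart of G} (deg(fst e) − 1))^{l−1}, i.e. M_l is at least m times the (l−1)-st power of the geometric mean over all darts e of (deg(fst e) − 1). -/
open SimpleGraph Finset

/-- The set of non-backtracking walks of length `l` in `G`, encoded as functions
`Fin l → G.Dart` such that consecutive darts are composable and the second is not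
the reverse of the first. -/
def nbWalkSet {V : Type*} [Fintype V] [DecidableEq V] (G : SimpleGraph V)
    [DecidableRel G.Adj] (l : ℕ) : Finset (Fin l → G.Dart) :=
  Finset.univ.filter fun e => ∀ i j : Fin l, (j : ℕ) = (i : ℕ) + 1 →
    (e i).snd = (e j).fst ∧ e j ≠ (e i).symm

section

variable {V : Type*} [Fintype V] [DecidableEq V] (G : SimpleGraph V) [DecidableRel G.Adj]

/-- The darts that may follow `e` in a non-backtracking walk. -/
def nbSucc (e : G.Dart) : Finset G.Dart :=
  univ.filter fun f => e.snd = f.fst ∧ f ≠ e.symm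

/-- The non-backtracking walks of length `k + 1` whose first dart is `e`. -/
def nbWalkSetFrom (k : ℕ) (e : G.Dart) : Finset (Fin (k + 1) → G.Dart) :=
  (nbWalkSet G (k + 1)).filter fun w => w 0 = e

/-- The concavity inequality for `log` with uniform weights, i.e. AM-GM. -/
theorem sum_log_le_card_mul {ι : Type*} (s : Finset ι) (hs : s.Nonempty) (a : ι → ℝ)
    (ha : ∀ i ∈ s, 0 < a i) :
    ∑ i ∈ s, Real.log (a i) ≤ #s * (Real.log (∑ i ∈ s, a i) - Real.log #s) := by
  have hc : (0 : ℝ) < #s := by exact_mod_cast hs.card_pos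
  have h := strictConcaveOn_log_Ioi.concaveOn.le_map_sum (t := s) (w := fun _ => (#s : ℝ)⁻¹)
    (p := a) (fun _ _ => by positivity) (by simp [hc.ne']) ha
  simp only [smul_eq_mul, ← mul_sum] at h
  rw [inv_mul_eq_div, inv_mul_eq_div, Real.log_div (sum_pos ha hs).ne' hc.ne', div_le_iff₀ hc] at h
  linarith

theorem card_darts_fst_eq (v : V) : #{e : G.Dart | e.fst = v} = G.degree v :=
  G.dart_fst_fiber_card_eq_degree v

theorem card_nbSucc (e : G.Dart) : #(nbSucc G e) = G.degree e.snd - 1 := by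
  have h : nbSucc G e = ({f : G.Dart | f.fst = e.snd} : Finset G.Dart).erase e.symm := by
    ext f
    simp [nbSucc, and_comm, eq_comm]
  rw [h, card_erase_of_mem (by simp), card_darts_fst_eq]

theorem card_nbPred (f : G.Dart) : #{e : G.Dart | f ∈ nbSucc G e} = G.degree f.fst - 1 := by
  rw [← card_darts_fst_eq, ← card_erase_of_mem (a := f) (by simp)]
  refine card_nbij' Dart.symm Dart.symm (fun e he => ?_) (fun e he => ?_)
    (fun _ _ => Dart.symm_symm _) (fun _ _ => Dart.symm_symm _)
  · obtain ⟨h, hne⟩ := (mem_filter.1 (mem_filter.1 (mem_coe.1 he)).2).2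
    exact mem_coe.2 (mem_erase.2 ⟨hne.symm, mem_filter.2 ⟨mem_univ _, h⟩⟩)
  · obtain ⟨hne, h⟩ := mem_erase.1 (mem_coe.1 he)
    refine mem_coe.2 (mem_filter.2 ⟨mem_univ _, mem_filter.2 ⟨mem_univ _, ?_, ?_⟩⟩)
    · exact (mem_filter.1 h).2
    · rw [Dart.symm_symm]
      exact hne.symm

theorem cons_mem_nbWalkSet (k : ℕ) (e : G.Dart) (w : Fin (k + 1) → G.Dart) :
    (Fin.cons e w : Fin (k + 2) → G.Dart) ∈ nbWalkSet G (k + 2) ↔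
      w 0 ∈ nbSucc G e ∧ w ∈ nbWalkSet G (k + 1) := by
  simp only [nbWalkSet, nbSucc, mem_filter, mem_univ, true_and]
  constructor
  · intro h
    refine ⟨by simpa using h 0 (Fin.succ 0) (by simp), fun i j hij => ?_⟩
    simpa using h i.succ j.succ (by simpa using hij)
  · rintro ⟨h0, h⟩ i j hij
    induction j using Fin.cases with
    | zero => simp at hij
    | succ j =>
      induction i using Fin.cases with
      | zero =>
        obtain rfl : j = 0 := Fin.ext (by simpa using hij)
        simpa using h0
      | succ i => simpa using h i j (by simpa using hij)

theorem card_nbWalkSetFrom_zero (e : G.Dart) : #(nbWalkSetFrom G 0 e) = 1 := by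
  rw [card_eq_one]
  refine ⟨fun _ => e, ?_⟩
  ext w
  simp only [nbWalkSetFrom, nbWalkSet, mem_filter, mem_univ, true_and, mem_singleton]
  constructor
  · rintro ⟨-, h⟩
    ext1 i
    obtain rfl : i = 0 := Fin.ext (by omega)
    exact h
  · rintro rfl
    exact ⟨fun i j hij => by omega, rfl⟩

theorem card_nbWalkSetFrom_succ (k : ℕ) (e : G.Dart) :
    #(nbWalkSetFrom G (k + 1) e) = ∑ f ∈ nbSucc G e, #(nbWalkSetFrom G k f) := by
  rw [← card_sigma]
  refine card_nbij' (fun w => ⟨w 1, Fin.tail w⟩) (fun p => Fin.cons e p.2) ?_ ?_ ?_ ?_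
  · intro w hw
    obtain ⟨hmem, rfl⟩ := mem_filter.1 (mem_coe.1 hw)
    rw [← Fin.cons_self_tail w, cons_mem_nbWalkSet] at hmem
    exact mem_coe.2 (mem_sigma.2 ⟨hmem.1, mem_filter.2 ⟨hmem.2, rfl⟩⟩)
  · rintro ⟨f, w⟩ hw
    obtain ⟨hf, hw⟩ := mem_sigma.1 (mem_coe.1 hw)
    obtain ⟨hw, rfl : w 0 = f⟩ := mem_filter.1 hw
    exact mem_coe.2 (mem_filter.2 ⟨(cons_mem_nbWalkSet G k e w).2 ⟨hf, hw⟩, rfl⟩)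
  · intro w hw
    obtain ⟨-, rfl⟩ := mem_filter.1 (mem_coe.1 hw)
    exact Fin.cons_self_tail w
  · rintro ⟨f, w⟩ hw
    obtain ⟨-, hw⟩ := mem_sigma.1 (mem_coe.1 hw)
    obtain ⟨-, rfl : w 0 = f⟩ := mem_filter.1 hw
    rfl

theorem card_nbWalkSet_succ (k : ℕ) :
    #(nbWalkSet G (k + 1)) = ∑ e, #(nbWalkSetFrom G k e) :=
  card_eq_sum_card_fiberwise fun _ _ => mem_coe.2 (mem_univ _)

variable {G}

theorem nbSucc_nonempty (hdeg : ∀ v : V, 2 ≤ G.degree v) (e : G.Dart) :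
    (nbSucc G e).Nonempty := by
  have := hdeg e.snd
  rw [← card_pos, card_nbSucc]
  omega

theorem card_nbWalkSetFrom_pos (hdeg : ∀ v : V, 2 ≤ G.degree v) (k : ℕ) (e : G.Dart) :
    0 < #(nbWalkSetFrom G k e) := by
  induction k generalizing e with
  | zero => simp [card_nbWalkSetFrom_zero]
  | succ k ih =>
    rw [card_nbWalkSetFrom_succ]
    exact sum_pos (fun f _ => ih f) (nbSucc_nonempty hdeg e)

/-- The uniform distribution on darts is stationary for the non-backtracking random walk. -/
theorem sum_average_nbSucc (hdeg : ∀ v : V, 2 ≤ G.degree v) (g : G.Dart → ℝ) :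
    ∑ e, (∑ f ∈ nbSucc G e, g f) / #(nbSucc G e) = ∑ f, g f := by
  simp_rw [sum_div]
  rw [sum_comm' (t' := univ) (s' := fun f => {e : G.Dart | f ∈ nbSucc G e}) (by simp)]
  refine sum_congr rfl fun f _ => ?_
  have hc : ∀ e ∈ ({e : G.Dart | f ∈ nbSucc G e} : Finset G.Dart),
      g f / #(nbSucc G e) = g f / (G.degree f.fst - 1 : ℕ) := by
    intro e he
    have h : e.snd = f.fst := (mem_filter.1 (mem_filter.1 he).2).2.1
    rw [card_nbSucc, h]
  have hpos : ((G.degree f.fst - 1 : ℕ) : ℝ) ≠ 0 := by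
    have := hdeg f.fst
    exact_mod_cast (by omega : G.degree f.fst - 1 ≠ 0)
  rw [sum_congr rfl hc, sum_const, card_nbPred, nsmul_eq_mul, mul_div_cancel₀ _ hpos]

theorem mul_sum_log_le_sum_log_card_nbWalkSetFrom (hdeg : ∀ v : V, 2 ≤ G.degree v) (k : ℕ) :
    k * ∑ e, Real.log #(nbSucc G e) ≤ ∑ e, Real.log #(nbWalkSetFrom G k e) := by
  induction k with
  | zero => simp [card_nbWalkSetFrom_zero]
  | succ k ih =>
    have hstep : ∀ e : G.Dart, Real.log #(nbSucc G e) +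
        (∑ f ∈ nbSucc G e, Real.log #(nbWalkSetFrom G k f)) / #(nbSucc G e) ≤
        Real.log #(nbWalkSetFrom G (k + 1) e) := by
      intro e
      have hne := nbSucc_nonempty hdeg e
      have h := sum_log_le_card_mul (nbSucc G e) hne (fun f => (#(nbWalkSetFrom G k f) : ℝ))
        fun f _ => by exact_mod_cast card_nbWalkSetFrom_pos hdeg k f
      have hc : (0 : ℝ) < #(nbSucc G e) := by exact_mod_cast hne.card_pos
      rw [← div_le_iff₀' hc] at h
      rw [card_nbWalkSetFrom_succ, Nat.cast_sum]
      linarith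
    have hsum := sum_le_sum fun e (_ : e ∈ univ) => hstep e
    rw [sum_add_distrib, sum_average_nbSucc hdeg] at hsum
    push_cast
    linarith

theorem prod_card_nbSucc : ∏ e, #(nbSucc G e) = ∏ e : G.Dart, (G.degree e.fst - 1) := by
  simp_rw [card_nbSucc]
  exact (Dart.symm_involutive.bijective.prod_comp fun e : G.Dart => G.degree e.fst - 1)

end

/-- Moore-type bound (Alon–Hoory–Linial): if every vertex of `G` has degree at least `2`,
`m` is the number of darts, and `M_l` is the number of non-backtracking walks of length
`l ≥ 1`, then `M_l ^ m ≥ m ^ m * (∏_e (deg (fst e) - 1)) ^ (l - 1)`. -/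
theorem moore_bound_nonbacktracking {V : Type*} [Fintype V] [DecidableEq V]
    (G : SimpleGraph V) [DecidableRel G.Adj]
    (hdeg : ∀ v : V, 2 ≤ G.degree v) (l : ℕ) (hl : 1 ≤ l) :
    (Fintype.card G.Dart) ^ (Fintype.card G.Dart) *
      (∏ e : G.Dart, (G.degree e.fst - 1)) ^ (l - 1) ≤
      (nbWalkSet G l).card ^ (Fintype.card G.Dart) := by
  obtain ⟨k, rfl⟩ : ∃ k, l = k + 1 := ⟨l - 1, by omega⟩
  rw [← prod_card_nbSucc, Nat.add_sub_cancel]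
  cases isEmpty_or_nonempty G.Dart with
  | inl h => simp
  | inr h =>
    have hs : ∀ e : G.Dart, (0 : ℝ) < #(nbSucc G e) := fun e => by
      exact_mod_cast (nbSucc_nonempty hdeg e).card_pos
    have hw : ∀ e : G.Dart, (0 : ℝ) < #(nbWalkSetFrom G k e) := fun e => by
      exact_mod_cast card_nbWalkSetFrom_pos hdeg k e
    have hm : (0 : ℝ) < Fintype.card G.Dart := by exact_mod_cast Fintype.card_pos
    have hp : (0 : ℝ) < ∏ e : G.Dart, (#(nbSucc G e) : ℝ) := prod_pos fun e _ => hs e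
    have hM : (0 : ℝ) < ∑ e : G.Dart, (#(nbWalkSetFrom G k e) : ℝ) :=
      sum_pos (fun e _ => hw e) univ_nonempty
    have h₁ := mul_sum_log_le_sum_log_card_nbWalkSetFrom hdeg k
    have h₂ := sum_log_le_card_mul univ univ_nonempty _ fun e _ => hw e
    rw [card_univ] at h₂
    rw [card_nbWalkSet_succ]
    rify
    rw [← Real.log_le_log_iff (by positivity) (by positivity),
      Real.log_mul (by positivity) (by positivity), Real.log_pow, Real.log_pow, Real.log_pow,
      Real.log_prod fun e _ => (hs e).ne']
    linarith
end

section
/- Let I and J be nonempty finite index sets, and let a : I → ℝ and b : J → ℝ satisfy a(i) ≥ 2 for all i ∈ I and b(j) ≥ 2 for all j ∈ J, together with Σ_{i∈I} a(i) = Σ_{j∈J} b(j). Write m = Σ_{i∈I} a(i) + Σ_{j∈J} b(j), ā = (Σ_{i} a(i))/|I| and b̄ = (Σ_{j} b(j))/|J|. Then Σ_{i∈I} a(i)·log(a(i) − 1) + Σ_{j∈J} b(j)·log(b(j) − 1) ≥ (m/2)·(log(ā − 1) + log(b̄ − 1)). -/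
open Finset

/-- The function `x ↦ x * log (x - 1)` is convex on `[2, ∞)`. -/
lemma convexOn_mul_log_sub_one :
    ConvexOn ℝ (Set.Ici 2) (fun x : ℝ => x * Real.log (x - 1)) := by
  refine convexOn_of_hasDerivWithinAt2_nonneg (convex_Ici 2)
    (f' := fun x => Real.log (x - 1) + x / (x - 1))
    (f'' := fun x => (x - 2) / (x - 1) ^ 2) ?_ ?_ ?_ ?_
  · refine continuousOn_id.mul (ContinuousOn.log (by fun_prop) fun x hx => ?_)
    rw [Set.mem_Ici] at hx
    linarith
  all_goals
    intro x hx
    rw [interior_Ici, Set.mem_Ioi] at hx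
    have hne : x - 1 ≠ 0 := by linarith
    have hsub : HasDerivAt (fun y : ℝ => y - 1) 1 x := (hasDerivAt_id' x).sub_const 1
  · refine HasDerivAt.hasDerivWithinAt
      (((hasDerivAt_id' x).mul (hsub.log hne)).congr_deriv ?_)
    field_simp
  · refine HasDerivAt.hasDerivWithinAt
      (((hsub.log hne).add ((hasDerivAt_id' x).div hsub hne)).congr_deriv ?_)
    field_simp
    ring
  · exact div_nonneg (by linarith) (sq_nonneg _)

/-- Jensen's inequality for `x ↦ x * log (x - 1)` with uniform weights. -/
lemma sum_mul_log_average_sub_one_le {I : Type*} [Fintype I] [Nonempty I] (a : I → ℝ)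
    (ha : ∀ i, 2 ≤ a i) :
    (∑ i, a i) * Real.log ((∑ i, a i) / (Fintype.card I : ℝ) - 1) ≤
      ∑ i, a i * Real.log (a i - 1) := by
  have hcard : (0 : ℝ) < Fintype.card I := by exact_mod_cast Fintype.card_pos
  have h := convexOn_mul_log_sub_one.map_sum_le (t := univ)
    (w := fun _ : I => (Fintype.card I : ℝ)⁻¹) (p := a)
    (fun _ _ => by positivity) (by simp [hcard.ne']) (fun i _ => ha i)
  simp only [smul_eq_mul, ← mul_sum] at h
  rw [inv_mul_eq_div, inv_mul_eq_div, div_mul_eq_mul_div] at h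
  exact (div_le_div_iff_of_pos_right hcard).mp h

/-- Bipartite version of the convexity inequality (Lemma 5.2(2)): if `a i ≥ 2`,
`b j ≥ 2` and `∑ a = ∑ b`, then with `m = ∑ a + ∑ b`, `ā = (∑ a)/|I|`, `b̄ = (∑ b)/|J|`,
one has `∑ a i * log (a i - 1) + ∑ b j * log (b j - 1) ≥ (m/2) * (log (ā - 1) + log (b̄ - 1))`. -/
theorem weighted_log_convexity_bipartite {I J : Type*} [Fintype I] [Nonempty I]
    [Fintype J] [Nonempty J] (a : I → ℝ) (b : J → ℝ)
    (ha : ∀ i, 2 ≤ a i) (hb : ∀ j, 2 ≤ b j)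
    (hab : ∑ i, a i = ∑ j, b j) :
    ((∑ i, a i + ∑ j, b j) / 2) *
        (Real.log ((∑ i, a i) / (Fintype.card I : ℝ) - 1) +
          Real.log ((∑ j, b j) / (Fintype.card J : ℝ) - 1)) ≤
      (∑ i, a i * Real.log (a i - 1)) + ∑ j, b j * Real.log (b j - 1) := by
  have hI := sum_mul_log_average_sub_one_le a ha
  have hJ := sum_mul_log_average_sub_one_le b hb
  rw [← hab] at hJ ⊢
  linarith
end

section
/- Let d ≥ 2 be an integer and let p : ℕ → ℝ[X] be a sequence of real polynomials satisfying p(1) = X, p(2) = X² − d, and p(l+1) = X·p(l) − (d−1)·p(l−1) for every l ≥ 2. Then for every l ≥ 1 and every real number x with |x| ≤ 2·sqrt(d−1), one has |p(l)(x)| ≤ (l+1)·(d−1)^{l/2}, where (d−1)^{l/2} denotes the real power (d−1)^{l/2}. -/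
open Polynomial

/-- On `[-1, 1]` the Chebyshev polynomial of the second kind `U n` is bounded by `n + 1`. -/
lemma abs_eval_chebyshev_U_le (n : ℕ) {t : ℝ} (ht : |t| ≤ 1) :
    |(Chebyshev.U ℝ n).eval t| ≤ n + 1 := by
  induction n with
  | zero => simp
  | succ n ih =>
    have hU : (Chebyshev.U ℝ ((n + 1 : ℕ) : ℤ)).eval t
        = t * (Chebyshev.U ℝ n).eval t + (Chebyshev.T ℝ ((n + 1 : ℕ) : ℤ)).eval t := by
      simp [Chebyshev.U_eq_X_mul_U_add_T]
    have hT := Chebyshev.abs_eval_T_real_le_one ((n + 1 : ℕ) : ℤ) ht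
    have hm : |t * (Chebyshev.U ℝ n).eval t| ≤ |(Chebyshev.U ℝ n).eval t| := by
      rw [abs_mul]
      exact mul_le_of_le_one_left (abs_nonneg _) ht
    rw [hU]
    push_cast at *
    linarith [abs_add_le (t * (Chebyshev.U ℝ n).eval t)
      ((Chebyshev.T ℝ ((n : ℤ) + 1)).eval t)]

/-- The non-backtracking polynomials at `2rt`, where `r ^ 2 = d - 1`, in terms of Chebyshev
polynomials at `t`. -/
lemma nonbacktracking_eval_eq_chebyshev {d r : ℝ} (hr : r ^ 2 = d - 1) {p : ℕ → ℝ[X]}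
    (h1 : p 1 = X) (h2 : p 2 = X ^ 2 - C d)
    (hrec : ∀ l : ℕ, 2 ≤ l → p (l + 1) = X * p l - C (d - 1) * p (l - 1))
    (t : ℝ) (l : ℕ) :
    r ^ 2 * (p (l + 1)).eval (2 * r * t) = r ^ (l + 1) *
      ((r ^ 2 - 1) * (Chebyshev.U ℝ ((l + 1 : ℕ) : ℤ)).eval t +
        2 * (Chebyshev.T ℝ ((l + 1 : ℕ) : ℤ)).eval t) := by
  induction l using Nat.twoStepInduction with
  | zero => simp [h1]; ring
  | one =>
    obtain rfl : d = r ^ 2 + 1 := by linarith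
    simp [h2, Chebyshev.U_two, Chebyshev.T_two, -mul_eq_mul_left_iff]
    ring
  | more l ih₁ ih₂ =>
    have hU : (Chebyshev.U ℝ ((l + 2 + 1 : ℕ) : ℤ)).eval t =
        2 * t * (Chebyshev.U ℝ ((l + 1 + 1 : ℕ) : ℤ)).eval t
          - (Chebyshev.U ℝ ((l + 1 : ℕ) : ℤ)).eval t := by
      have h := congrArg (eval t) (Chebyshev.U_add_two ℝ ((l + 1 : ℕ) : ℤ))
      simp only [eval_sub, eval_mul, eval_X, eval_ofNat] at h
      exact h
    have hT : (Chebyshev.T ℝ ((l + 2 + 1 : ℕ) : ℤ)).eval t =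
        2 * t * (Chebyshev.T ℝ ((l + 1 + 1 : ℕ) : ℤ)).eval t
          - (Chebyshev.T ℝ ((l + 1 : ℕ) : ℤ)).eval t := by
      have h := congrArg (eval t) (Chebyshev.T_add_two ℝ ((l + 1 : ℕ) : ℤ))
      simp only [eval_sub, eval_mul, eval_X, eval_ofNat] at h
      exact h
    have hp := hrec (l + 2) (by omega)
    rw [hU, hT, hp, ← hr, show l + 2 - 1 = l + 1 by omega]
    simp only [eval_sub, eval_mul, eval_X, eval_C]
    linear_combination (2 * r * t) * ih₂ - r ^ 2 * ih₁

/-- Spectral bound from the proof of Lemma 5.3: the polynomials `p l` expressing the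
non-backtracking walk operators of a `d`-regular graph in terms of the adjacency operator
satisfy `|p l (x)| ≤ (l+1) * (d-1)^(l/2)` on the Ramanujan interval `|x| ≤ 2√(d-1)`. -/
theorem nonbacktracking_polynomial_bound (d : ℕ) (hd : 2 ≤ d) (p : ℕ → Polynomial ℝ)
    (h1 : p 1 = X) (h2 : p 2 = X ^ 2 - C (d : ℝ))
    (hrec : ∀ l : ℕ, 2 ≤ l → p (l + 1) = X * p l - C ((d : ℝ) - 1) * p (l - 1)) :
    ∀ l : ℕ, 1 ≤ l → ∀ x : ℝ, |x| ≤ 2 * Real.sqrt ((d : ℝ) - 1) →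
      |(p l).eval x| ≤ ((l : ℝ) + 1) * ((d : ℝ) - 1) ^ ((l : ℝ) / 2) := by
  intro l hl x hx
  have hd' : (2 : ℝ) ≤ d := by exact_mod_cast hd
  have hpow : ((d : ℝ) - 1) ^ ((l : ℝ) / 2) = Real.sqrt ((d : ℝ) - 1) ^ l :=
    Real.rpow_div_two_eq_sqrt _ (by linarith) |>.trans (Real.rpow_natCast _ _)
  rw [hpow]
  have hr : Real.sqrt ((d : ℝ) - 1) ^ 2 = d - 1 := Real.sq_sqrt (by linarith)
  have hr0 : 0 < Real.sqrt ((d : ℝ) - 1) := Real.sqrt_pos.mpr (by linarith)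
  generalize Real.sqrt ((d : ℝ) - 1) = r at *
  have hr1 : 1 ≤ r ^ 2 := by linarith
  obtain ⟨t, rfl⟩ : ∃ t, x = 2 * r * t := ⟨x / (2 * r), by field_simp⟩
  have ht : |t| ≤ 1 := by
    rw [abs_mul, abs_of_pos (by positivity : 0 < 2 * r)] at hx
    exact le_of_mul_le_mul_left (by linarith) (by positivity : 0 < 2 * r)
  have key := nonbacktracking_eval_eq_chebyshev hr h1 h2 hrec t (l - 1)
  rw [Nat.sub_add_cancel hl] at key
  have hU := abs_eval_chebyshev_U_le l ht
  have hT := Chebyshev.abs_eval_T_real_le_one (l : ℤ) ht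
  have hl' : (1 : ℝ) ≤ l := by exact_mod_cast hl
  have hUT : |(r ^ 2 - 1) * (Chebyshev.U ℝ l).eval t + 2 * (Chebyshev.T ℝ l).eval t|
      ≤ r ^ 2 * (l + 1) := by
    refine (abs_add_le _ _).trans ?_
    rw [abs_mul, abs_mul, abs_of_nonneg (by linarith : 0 ≤ r ^ 2 - 1), abs_two]
    nlinarith [mul_le_mul_of_nonneg_left hU (by linarith : 0 ≤ r ^ 2 - 1)]
  refine le_of_mul_le_mul_left ?_ (by positivity : 0 < r ^ 2)
  calc r ^ 2 * |(p l).eval (2 * r * t)|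
      = |r ^ 2 * (p l).eval (2 * r * t)| := by rw [abs_mul, abs_of_pos (by positivity : 0 < r ^ 2)]
    _ = r ^ l * |(r ^ 2 - 1) * (Chebyshev.U ℝ l).eval t + 2 * (Chebyshev.T ℝ l).eval t| := by
      rw [key, abs_mul, abs_of_pos (by positivity : 0 < r ^ l)]
    _ ≤ r ^ l * (r ^ 2 * (l + 1)) := by gcongr
    _ = r ^ 2 * ((l + 1) * r ^ l) := by ring
end

section
/- Let d ≥ 2 be an integer and let p : ℕ → ℝ[X] be a sequence of real polynomials satisfying p(1) = X, p(2) = X² − d, and p(l+1) = X·p(l) − (d−1)·p(l−1) for every l ≥ 2. Then for every l ≥ 2 and every real number x, p(l)(x) = (d−1)^{l/2}·((1 − 1/(d−1))·U_l(x/(2·sqrt(d−1))) + (2/(d−1))·T_l(x/(2·sqrt(d−1)))), where T_l and U_l are the Chebyshev polynomials of the first and second kind over ℝ and (d−1)^{l/2} denotes the real power. -/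
open Polynomial

/-- A sequence satisfying the recurrence of the non-backtracking walk polynomials, in the
normalization `s = √(d-1)`, `x = 2 s y`, is a combination of Chebyshev polynomials. -/
theorem eq_pow_mul_chebyshev_of_recurrence {K : Type*} [Field K] {s y : K} (hs : s ≠ 0)
    {a : ℕ → K} (h1 : a 1 = 2 * s * y) (h2 : a 2 = (2 * s * y) ^ 2 - (s ^ 2 + 1))
    (hrec : ∀ l, 2 ≤ l → a (l + 1) = 2 * s * y * a l - s ^ 2 * a (l - 1)) (n : ℕ) :
    a (n + 1) = s ^ (n + 1) *
      ((1 - 1 / s ^ 2) * (Chebyshev.U K ((n + 1 : ℕ) : ℤ)).eval y +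
        2 / s ^ 2 * (Chebyshev.T K ((n + 1 : ℕ) : ℤ)).eval y) := by
  induction n using Nat.twoStepInduction with
  | zero =>
    simp only [zero_add, Nat.cast_one, Chebyshev.U_one, Chebyshev.T_one, h1, eval_mul, eval_X,
      eval_ofNat]
    field_simp
    ring
  | one =>
    simp only [Nat.reduceAdd, Nat.cast_ofNat, Chebyshev.U_two, Chebyshev.T_two, h2, eval_mul,
      eval_sub, eval_pow, eval_X, eval_ofNat, eval_one]
    field_simp
    ring
  | more n ih₀ ih₁ =>
    have hU := congrArg (eval y) (Chebyshev.U_add_two K ((n + 1 : ℕ) : ℤ))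
    have hT := congrArg (eval y) (Chebyshev.T_add_two K ((n + 1 : ℕ) : ℤ))
    simp only [eval_sub, eval_mul, eval_X, eval_ofNat] at hU hT
    rw [hrec (n + 2) (by lia), Nat.add_sub_assoc (by lia), ih₀, ih₁,
      show ((n + 2 + 1 : ℕ) : ℤ) = ((n + 1 : ℕ) : ℤ) + 2 by push_cast; ring, hU, hT,
      show ((n + 1 + 1 : ℕ) : ℤ) = ((n + 1 : ℕ) : ℤ) + 1 by push_cast; ring]
    ring

/-- Explicit Chebyshev expression for the non-backtracking walk polynomials of a
`d`-regular graph (proof of Lemma 5.3): for `l ≥ 2` and all real `x`,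
`p l (x) = (d-1)^(l/2) * ((1 - 1/(d-1)) U_l(x/(2√(d-1))) + (2/(d-1)) T_l(x/(2√(d-1))))`. -/
theorem nonbacktracking_polynomial_chebyshev (d : ℕ) (hd : 2 ≤ d) (p : ℕ → Polynomial ℝ)
    (h1 : p 1 = X) (h2 : p 2 = X ^ 2 - C (d : ℝ))
    (hrec : ∀ l : ℕ, 2 ≤ l → p (l + 1) = X * p l - C ((d : ℝ) - 1) * p (l - 1)) :
    ∀ l : ℕ, 2 ≤ l → ∀ x : ℝ,
      (p l).eval x = ((d : ℝ) - 1) ^ ((l : ℝ) / 2) *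
        ((1 - 1 / ((d : ℝ) - 1)) *
            (Polynomial.Chebyshev.U ℝ (l : ℤ)).eval (x / (2 * Real.sqrt ((d : ℝ) - 1))) +
          (2 / ((d : ℝ) - 1)) *
            (Polynomial.Chebyshev.T ℝ (l : ℤ)).eval (x / (2 * Real.sqrt ((d : ℝ) - 1)))) := by
  intro l hl x
  have hq : (0 : ℝ) < (d : ℝ) - 1 := by
    have : (2 : ℝ) ≤ d := by exact_mod_cast hd
    linarith
  have hs := Real.sqrt_pos.mpr hq
  have hsq := Real.sq_sqrt hq.le
  have hx : 2 * √((d : ℝ) - 1) * (x / (2 * √((d : ℝ) - 1))) = x := by field_simp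
  have hpow : ((d : ℝ) - 1) ^ ((l : ℝ) / 2) = √((d : ℝ) - 1) ^ l := by
    rw [Real.sqrt_eq_rpow, ← Real.rpow_mul_natCast hq.le]
    ring_nf
  obtain ⟨n, rfl⟩ := Nat.exists_eq_add_of_le' (show 1 ≤ l by lia)
  have key := eq_pow_mul_chebyshev_of_recurrence hs.ne' (y := x / (2 * √((d : ℝ) - 1)))
    (a := fun l => (p l).eval x) (by simp [h1, hx]) (by simp [h2, hx, hsq])
    (fun l hl => by simp [hrec l hl, hx, hsq]) n
  rwa [hsq, ← hpow] at key
end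

section
/- Let d, s, m, e be real numbers with d ≥ 2, s > 0, m > 0, s < e, and e ≤ d·s. If (e/s − 1)·(e/m − 1) ≤ d − 1, then m − e ≥ −(d/2)·s. -/
/-- The algebraic inequality at the heart of the proof of Theorem 5.5:
if `d ≥ 2`, `0 < s`, `0 < m`, `s < e ≤ d·s` and `(e/s - 1)(e/m - 1) ≤ d - 1`,
then `m - e ≥ -(d/2)·s`. -/
theorem vertex_expansion_algebraic_core (d s m e : ℝ) (hd : 2 ≤ d) (hs : 0 < s)
    (hm : 0 < m) (hse : s < e) (hed : e ≤ d * s)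
    (h : (e / s - 1) * (e / m - 1) ≤ d - 1) :
    -(d / 2) * s ≤ m - e := by
  have hpoly : e * (e - s) ≤ m * (e + (d - 2) * s) := by
    have hmul := mul_le_mul_of_nonneg_right h (mul_pos hs hm).le
    have hclear : (e / s - 1) * (e / m - 1) * (s * m) = (e - s) * (e - m) := by
      field_simp
    linarith
  have hpos : 0 < e + (d - 2) * s :=
    add_pos_of_pos_of_nonneg (hs.trans hse) (mul_nonneg (sub_nonneg.2 hd) hs.le)
  have hgap : 0 ≤ s * ((d - 2) * (d * s - e)) :=
    mul_nonneg hs.le (mul_nonneg (sub_nonneg.2 hd) (sub_nonneg.2 hed))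
  have hle : e - d / 2 * s ≤ m := by
    refine le_of_mul_le_mul_right ?_ hpos
    linarith
  linarith
end

section
/- Let G be a group, S a finite subset of G that is symmetric (s ∈ S implies s⁻¹ ∈ S), and H a subgroup of G such that s² ∈ H for every s ∈ S. Let ε : H → {±1} be a group homomorphism (into the units of ℤ) with ε(s²) = −1 for every s ∈ S. Define f : G → ℤ by f(x) = ε(x) if x ∈ H and f(x) = 0 otherwise. Then for every x ∈ G, Σ_{s∈S} f(s·x) = 0; that is, f is an eigenfunction with eigenvalue 0 of the adjacency operator of the Cayley graph of G with respect to S. -/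
open Finset

/-- Abstract form of Theorem 1.8 (concentrated eigenfunctions of eigenvalue `0`):
let `S` be a finite symmetric subset of a group `G`, `H` a subgroup containing the
squares of elements of `S`, and `ε : H → ℤˣ` a homomorphism with `ε(s²) = -1` for all
`s ∈ S`. Then the function `f` equal to `ε` on `H` and `0` elsewhere satisfies
`∑_{s ∈ S} f (s·x) = 0` for every `x`, i.e. it is an eigenfunction of eigenvalue `0`
of the adjacency operator of the Cayley graph of `G` with respect to `S`. -/
theorem cayley_zero_eigenfunction {G : Type*} [Group G] (S : Finset G)
    (hsymm : ∀ s ∈ S, s⁻¹ ∈ S) (H : Subgroup G) [DecidablePred (· ∈ H)]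
    (hsq : ∀ s ∈ S, s ^ 2 ∈ H)
    (ε : H →* ℤˣ) (hε : ∀ (s : G) (hs : s ∈ S), ε ⟨s ^ 2, hsq s hs⟩ = -1)
    (f : G → ℤ)
    (hf : ∀ x : G, f x = if h : x ∈ H then ((ε ⟨x, h⟩ : ℤˣ) : ℤ) else 0) :
    ∀ x : G, ∑ s ∈ S, f (s * x) = 0 := by
  intro x
  have hneg : ∀ s ∈ S, f (s * x) = -f (s⁻¹ * x) := by
    intro s hs
    have hx : s * x = s ^ 2 * (s⁻¹ * x) := by group
    rw [hx, hf, hf]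
    by_cases h : s⁻¹ * x ∈ H
    · have hmul : ε ⟨s ^ 2 * (s⁻¹ * x), H.mul_mem (hsq s hs) h⟩ = -ε ⟨s⁻¹ * x, h⟩ := by
        rw [← neg_one_mul, ← hε s hs, ← map_mul]
        rfl
      rw [dif_pos (H.mul_mem (hsq s hs) h), dif_pos h, hmul, Units.val_neg]
    · rw [dif_neg (mt (H.mul_mem_cancel_left (hsq s hs)).mp h), dif_neg h, neg_zero]
  have hinv : ∑ s ∈ S, f (s⁻¹ * x) = ∑ s ∈ S, f (s * x) :=
    Finset.sum_nbij' (·⁻¹) (·⁻¹) hsymm hsymm (by simp) (by simp) (by simp)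
  have hsum := Finset.sum_congr rfl hneg
  rw [Finset.sum_neg_distrib, hinv] at hsum
  exact self_eq_neg.mp hsum
end

section
/- Let G be a group, S a finite subset of G that is symmetric (s ∈ S implies s⁻¹ ∈ S), and H a subgroup of G such that for every s ∈ S one has s² ∈ H and s² ≠ 1. Then for every x ∈ G, the number of elements s ∈ S with s·x ∈ H is even. -/
open Finset

/-- A finite set with a fixed-point-free involution has even cardinality. -/
theorem Finset.even_card_of_fixedPointFree_involution {α : Type*} (s : Finset α) (f : α → α)
    (hmem : ∀ a ∈ s, f a ∈ s) (hinv : ∀ a ∈ s, f (f a) = a) (hne : ∀ a ∈ s, f a ≠ a) :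
    Even s.card := by
  have h : ∑ _a ∈ s, (1 : ZMod 2) = 0 :=
    Finset.sum_involution (fun a _ => f a) (fun _ _ => by decide) (fun a ha _ => hne a ha)
      hmem hinv
  rw [← ZMod.natCast_eq_zero_iff_even]
  simpa using h

/-- Group-theoretic core of Theorems 1.1 and 1.4 (no odd neighbors): if `S` is a finite
symmetric subset of a group `G` and `H` is a subgroup with `s² ∈ H` and `s² ≠ 1` for
every `s ∈ S`, then for every `x ∈ G` the number of `s ∈ S` with `s·x ∈ H` is even. -/
theorem even_neighbors_in_subgroup {G : Type*} [Group G] (S : Finset G)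
    (hsymm : ∀ s ∈ S, s⁻¹ ∈ S) (H : Subgroup G) [DecidablePred (· ∈ H)]
    (hsq : ∀ s ∈ S, s ^ 2 ∈ H) (hne : ∀ s ∈ S, s ^ 2 ≠ 1) :
    ∀ x : G, Even ((S.filter fun s => s * x ∈ H).card) := by
  intro x
  refine Finset.even_card_of_fixedPointFree_involution _ (·⁻¹) ?_ (fun s _ => inv_inv s) ?_
  · intro s hs
    obtain ⟨hsS, hsx⟩ := Finset.mem_filter.mp hs
    refine Finset.mem_filter.mpr ⟨hsymm s hsS, ?_⟩
    have h := H.mul_mem (H.inv_mem (hsq s hsS)) hsx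
    rwa [show (s ^ 2)⁻¹ * (s * x) = s⁻¹ * x by group] at h
  · intro s hs h
    refine hne s (Finset.mem_filter.mp hs).1 ?_
    rw [sq]
    exact inv_eq_iff_mul_eq_one.mp h
end

section
/- Let α be a type, F = FreeGroup α the free group on α, S = {of(a) : a ∈ α} ∪ {of(a)⁻¹ : a ∈ α} the symmetric set of free generators, and H ≤ F the subgroup generated by {of(a)² : a ∈ α}. Then for every x ∈ F such that s·x ∈ H for some s ∈ S, the set {s ∈ S : s·x ∈ H} has exactly two elements (namely a generator-or-inverse s and its inverse s⁻¹). -/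
namespace FreeGroup

open Classical in
/-- The parity of the total exponent of the generator `a`. -/
noncomputable def exponentParity {α : Type*} (a : α) :
    FreeGroup α →* Multiplicative (ZMod 2) :=
  lift fun b => if b = a then Multiplicative.ofAdd 1 else 1

open Classical in
theorem exponentParity_of {α : Type*} (a b : α) :
    exponentParity a (of b) = if b = a then Multiplicative.ofAdd 1 else 1 :=
  lift_apply_of ..

theorem closure_sq_le_ker_exponentParity {α : Type*} (a : α) :
    Subgroup.closure (Set.range fun b : α => of b ^ 2) ≤ (exponentParity a).ker := by
  rw [Subgroup.closure_le]
  rintro _ ⟨b, rfl⟩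
  rw [SetLike.mem_coe, MonoidHom.mem_ker, map_pow]
  generalize exponentParity a (of b) = z
  revert z
  decide

theorem exponentParity_eq_of_mul_mem {α : Type*} {x s t : FreeGroup α}
    (hs : s * x ∈ Subgroup.closure (Set.range fun b : α => of b ^ 2))
    (ht : t * x ∈ Subgroup.closure (Set.range fun b : α => of b ^ 2)) (a : α) :
    exponentParity a s = exponentParity a t := by
  have h₁ := closure_sq_le_ker_exponentParity a hs
  have h₂ := closure_sq_le_ker_exponentParity a ht
  rw [MonoidHom.mem_ker, MonoidHom.map_mul] at h₁ h₂
  exact mul_right_cancel (h₁.trans h₂.symm)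

theorem eq_of_exponentParity_of_eq {α : Type*} {a b : α}
    (h : exponentParity a (of a) = exponentParity a (of b)) : b = a := by
  by_contra hne
  rw [exponentParity_of, exponentParity_of, if_pos rfl, if_neg hne] at h
  exact absurd h (by decide)

theorem exponentParity_inv {α : Type*} (a : α) (s : FreeGroup α) :
    exponentParity a s⁻¹ = exponentParity a s := by
  rw [MonoidHom.map_inv]
  generalize exponentParity a s = z
  revert z
  decide

theorem of_ne_inv_of {α : Type*} (a : α) : of a ≠ (of a)⁻¹ := by
  intro h
  have := congrArg (lift fun _ : α => Multiplicative.ofAdd (1 : ℤ)) h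
  rw [MonoidHom.map_inv, lift_apply_of] at this
  exact absurd this (by decide)

end FreeGroup


/-- Free-group form of Lemma 1.2: in the free group on `α`, let `S` be the symmetric set
of free generators and their inverses and `H` the subgroup generated by the squares of
the free generators. Then every `x` such that `s·x ∈ H` for some `s ∈ S` has exactly two
elements `s ∈ S` with `s·x ∈ H`; i.e. the embedded vertex set of the smaller tree has no
unique neighbors, every neighbor being connected to it by precisely two edges. -/
theorem free_group_two_neighbors {α : Type*} (S : Set (FreeGroup α))
    (hS : S = Set.range FreeGroup.of ∪ Set.range fun a => (FreeGroup.of a)⁻¹)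
    (H : Subgroup (FreeGroup α))
    (hH : H = Subgroup.closure (Set.range fun a => (FreeGroup.of a) ^ 2))
    (x : FreeGroup α) (hx : ∃ s ∈ S, s * x ∈ H) :
    {s ∈ S | s * x ∈ H}.ncard = 2 := by
  subst hS hH
  have key : ∀ a, FreeGroup.of a * x ∈
      Subgroup.closure (Set.range fun a : α => FreeGroup.of a ^ 2) ↔
      (FreeGroup.of a)⁻¹ * x ∈
        Subgroup.closure (Set.range fun a : α => FreeGroup.of a ^ 2) := by
    intro a
    have hsq : FreeGroup.of a ^ 2 ∈
        Subgroup.closure (Set.range fun a : α => FreeGroup.of a ^ 2) :=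
      Subgroup.subset_closure ⟨a, rfl⟩
    rw [← Subgroup.mul_mem_cancel_left _ hsq (y := (FreeGroup.of a)⁻¹ * x)]
    simp [pow_two, mul_assoc]
  obtain ⟨a, ha⟩ : ∃ a, FreeGroup.of a * x ∈
      Subgroup.closure (Set.range fun a : α => FreeGroup.of a ^ 2) := by
    obtain ⟨_, ⟨a, rfl⟩ | ⟨a, rfl⟩, h⟩ := hx
    · exact ⟨a, h⟩
    · exact ⟨a, (key a).2 h⟩
  refine Set.ncard_eq_two.2 ⟨_, _, FreeGroup.of_ne_inv_of a, ?_⟩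
  ext s
  simp only [Set.mem_ofPred_eq, Set.mem_insert_iff, Set.mem_singleton_iff]
  constructor
  · rintro ⟨hs, h⟩
    have hp := FreeGroup.exponentParity_eq_of_mul_mem ha h a
    obtain ⟨b, rfl⟩ | ⟨b, rfl⟩ := hs
    · rw [FreeGroup.eq_of_exponentParity_of_eq hp]
      exact Or.inl rfl
    · rw [FreeGroup.exponentParity_inv] at hp
      rw [FreeGroup.eq_of_exponentParity_of_eq hp]
      exact Or.inr rfl
  · rintro (rfl | rfl)
    · exact ⟨Or.inl ⟨a, rfl⟩, ha⟩
    · exact ⟨Or.inr ⟨a, rfl⟩, (key a).1 ha⟩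
end

section
/- Let F be a finite field of odd cardinality q, and let h be a monic irreducible polynomial over F with h(0) ≠ 0 and natural degree m ≥ 1. Let K = F[X]/(h) (the field AdjoinRoot h, a finite field of cardinality q^m), and let r ∈ K be the image of X (the root of h). Then quadraticChar K (r) = (−1)^{((q−1)/2)·m} · quadraticChar F (h(0)), where quadraticChar denotes the quadratic character of a finite field with values in ℤ. -/
open Polynomial

/-- Over a finite field `F` of odd characteristic, the quadratic character of a finite extension
`K` is the quadratic character of `F` composed with the norm. -/
theorem quadraticChar_eq_quadraticChar_norm {F K : Type*} [Field F] [Fintype F] [DecidableEq F]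
    [Field K] [Fintype K] [DecidableEq K] [Algebra F K] (hF : ringChar F ≠ 2) (x : K) :
    quadraticChar K x = quadraticChar F (Algebra.norm F x) := by
  have hK : ringChar K ≠ 2 := Algebra.ringChar_eq F K ▸ hF
  refine Int.cast_injOn_of_ringChar_ne_two hK (quadraticChar_isQuadratic K x)
    (quadraticChar_isQuadratic F _) ?_
  rw [quadraticChar_eq_pow_of_char_ne_two' hK, ← map_intCast (algebraMap F K),
    quadraticChar_eq_pow_of_char_ne_two' hF, map_pow, FiniteField.algebraMap_norm_eq_pow,
    ← pow_mul, Nat.card_eq_fintype_card, Nat.card_eq_fintype_card]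
  congr 1
  have hdvd : Fintype.card F - 1 ∣ Fintype.card K - 1 := by
    rw [Module.card_eq_pow_finrank (K := F) (V := K)]
    simpa using Nat.sub_dvd_pow_sub_pow (Fintype.card F) 1 (Module.finrank F K)
  obtain ⟨c, hc⟩ := hdvd
  have hoddF := FiniteField.odd_card_of_char_ne_two hF
  have hoddK := FiniteField.odd_card_of_char_ne_two hK
  have hpos : 0 < Fintype.card F - 1 := Nat.sub_pos_of_lt Fintype.one_lt_card
  rw [hc, Nat.mul_div_cancel_left c hpos]
  have htwo : Fintype.card F - 1 = 2 * (Fintype.card F / 2) := by lia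
  rw [htwo, mul_assoc] at hc
  rw [mul_comm c]
  lia

/-- The norm of the root of a monic polynomial `h` is `(-1) ^ deg h * h(0)`. -/
theorem AdjoinRoot.norm_root_of_monic {F : Type*} [Field F] {h : F[X]} (hmonic : h.Monic) :
    Algebra.norm F (AdjoinRoot.root h) = (-1) ^ h.natDegree * h.eval 0 := by
  have := Algebra.PowerBasis.norm_gen_eq_coeff_zero_minpoly
    (AdjoinRoot.powerBasis hmonic.ne_zero)
  rwa [AdjoinRoot.minpoly_powerBasis_gen_of_monic hmonic, AdjoinRoot.powerBasis_gen,
    AdjoinRoot.powerBasis_dim, coeff_zero_eq_eval_zero] at this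

/-- Quadratic reciprocity computation from Section 2 of the paper: for a monic
irreducible polynomial `h` of degree `m ≥ 1` over a finite field `F` of odd cardinality
`q`, with `h(0) ≠ 0`, the quadratic character of the root `r` of `h` in the field
`K = F[X]/(h)` equals `(-1)^(((q-1)/2)·m) · χ_F(h(0))`, where `χ` denotes the quadratic
character. This is the function-field Legendre symbol identity
`(s / h) = (-1)^(((q-1)/2)·deg h) (h(0) / q)`. -/
theorem legendre_symbol_of_root {F : Type*} [Field F] [Fintype F] [DecidableEq F]
    (q : ℕ) (hq : Fintype.card F = q) (hodd : Odd q)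
    (h : Polynomial F) (hmonic : h.Monic) [Fact (Irreducible h)]
    (h0 : h.eval 0 ≠ 0) (m : ℕ) (hm : h.natDegree = m) (hm1 : 1 ≤ m)
    [Fintype (AdjoinRoot h)] [DecidableEq (AdjoinRoot h)] :
    quadraticChar (AdjoinRoot h) (AdjoinRoot.root h) =
      (-1 : ℤ) ^ ((q - 1) / 2 * m) * quadraticChar F (h.eval 0) := by
  have hF : ringChar F ≠ 2 := by
    rw [Ne, FiniteField.even_card_iff_char_two, hq]
    exact Nat.odd_iff.mp hodd ▸ one_ne_zero
  have hq2 : (q - 1) / 2 = q / 2 := by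
    have := Nat.odd_iff.mp hodd
    lia
  rw [quadraticChar_eq_quadraticChar_norm hF, AdjoinRoot.norm_root_of_monic hmonic, map_mul,
    map_pow, quadraticChar_neg_one hF, hq, ZMod.χ₄_eq_neg_one_pow (Nat.odd_iff.mp hodd), hm,
    hq2, pow_mul]
end

section
/- Let F be a finite field of odd cardinality q, let h be a monic irreducible polynomial over F of even natural degree m ≥ 2, and let c ∈ F with h(c) ≠ 0. Let K = F[X]/(h) (the field AdjoinRoot h) and let r ∈ K be the image of X. Then quadraticChar K (r − c) = quadraticChar F (h(c)), where c is identified with its image in K and quadraticChar denotes the quadratic character of a finite field with values in ℤ. -/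
open Polynomial

/-- The quadratic character of an extension of finite fields of odd characteristic is the
quadratic character of the base field composed with the norm. -/
theorem quadraticChar_norm {F K : Type*} [Field F] [Fintype F] [DecidableEq F]
    [Field K] [Fintype K] [DecidableEq K] [Algebra F K] (hF : ringChar F ≠ 2) (x : K) :
    quadraticChar F (Algebra.norm F x) = quadraticChar K x := by
  have hK : ringChar K ≠ 2 := by rwa [← Algebra.ringChar_eq F K]
  rcases eq_or_ne x 0 with rfl | hx
  · simp
  have hpow : algebraMap F K (Algebra.norm F x ^ (Fintype.card F / 2)) =
      x ^ (Fintype.card K / 2) := by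
    rw [map_pow, FiniteField.algebraMap_norm_eq_pow, ← pow_mul,
      Nat.card_eq_fintype_card, Nat.card_eq_fintype_card]
    congr 1
    obtain ⟨s, hs⟩ : Fintype.card F - 1 ∣ Fintype.card K - 1 := by
      rw [Module.card_eq_pow_finrank (K := F) (V := K)]
      simpa using Nat.sub_dvd_pow_sub_pow (Fintype.card F) 1 (Module.finrank F K)
    have hF' := Nat.two_mul_odd_div_two (FiniteField.odd_card_of_char_ne_two hF)
    have hK' := Nat.two_mul_odd_div_two (FiniteField.odd_card_of_char_ne_two hK)
    have hpos : 0 < Fintype.card F - 1 := Nat.sub_pos_of_lt Fintype.one_lt_card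
    rw [hs, Nat.mul_div_cancel_left _ hpos]
    rw [hs, ← hF'] at hK'
    linarith
  rw [quadraticChar_eq_pow_of_char_ne_two hF (Algebra.norm_ne_zero_iff.mpr hx),
    quadraticChar_eq_pow_of_char_ne_two hK hx, ← hpow]
  simp only [map_eq_one_iff _ (algebraMap F K).injective]

/-- The norm of `c - r`, where `r` is the root adjoined to `F` by a monic polynomial `h`,
is `h(c)`. -/
theorem AdjoinRoot.norm_algebraMap_sub_root {F : Type*} [Field F] {h : F[X]}
    (hmonic : h.Monic) (c : F) :
    Algebra.norm F (algebraMap F (AdjoinRoot h) c - AdjoinRoot.root h) = h.eval c := by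
  have hb := charpoly_leftMulMatrix (AdjoinRoot.powerBasis hmonic.ne_zero)
  rw [AdjoinRoot.minpoly_powerBasis_gen_of_monic hmonic, AdjoinRoot.powerBasis_gen] at hb
  rw [Algebra.norm_eq_matrix_det (AdjoinRoot.powerBasis hmonic.ne_zero).basis, map_sub,
    AlgHom.commutes, ← congrArg (eval c) hb, Matrix.eval_charpoly]
  rfl

/-- Quadratic reciprocity computation from Section 2 of the paper, even-degree case:
for a monic irreducible polynomial `h` of even degree `m ≥ 2` over a finite field `F`
of odd cardinality `q`, and `c ∈ F` with `h(c) ≠ 0`, the quadratic character of `r - c`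
in the field `K = F[X]/(h)` (with `r` the root of `h`) equals `χ_F(h(c))`. This is the
identity `((t - c) / h(t)) = (h(c) / q)` for `h` of even degree. -/
theorem legendre_symbol_of_root_sub {F : Type*} [Field F] [Fintype F] [DecidableEq F]
    (q : ℕ) (hq : Fintype.card F = q) (hodd : Odd q)
    (h : Polynomial F) (hmonic : h.Monic) [Fact (Irreducible h)]
    (m : ℕ) (hm : h.natDegree = m) (hm2 : 2 ≤ m) (heven : Even m)
    (c : F) (hc : h.eval c ≠ 0)
    [Fintype (AdjoinRoot h)] [DecidableEq (AdjoinRoot h)] :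
    quadraticChar (AdjoinRoot h) (AdjoinRoot.root h - algebraMap F (AdjoinRoot h) c) =
      quadraticChar F (h.eval c) := by
  have hF : ringChar F ≠ 2 := by
    rw [Ne, FiniteField.even_card_iff_char_two, hq]
    have := Nat.odd_iff.mp hodd
    omega
  have hfin : Even (Module.finrank F (AdjoinRoot h)) := by
    rwa [(AdjoinRoot.powerBasis hmonic.ne_zero).finrank, AdjoinRoot.powerBasis_dim, hm]
  have hneg : Algebra.norm F (-1 : AdjoinRoot h) = 1 := by
    have := Algebra.norm_algebraMap (S := AdjoinRoot h) (-1 : F)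
    rwa [map_neg, map_one, hfin.neg_one_pow] at this
  rw [← quadraticChar_norm hF, ← neg_sub, ← neg_one_mul, map_mul, hneg, one_mul,
    AdjoinRoot.norm_algebraMap_sub_root hmonic]
end

section
/- Let G be a finite simple graph in which every vertex has degree at least 2, let m be the total number of darts of G, let n be the number of vertices, and let l ≥ 1 be a natural number. Let M_l denote the number of non-backtracking walks of length l in G, and let d̄ = m/n be the average degree. Then M_l ≥ m·(d̄ − 1)^{l−1} (as an inequality of real numbers). -/
open SimpleGraph Finset

/-- Jensen's inequality for the logarithm of a finite sum of positive reals. -/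
theorem card_mul_log_card_add_sum_log_le {ι : Type*} (s : Finset ι) (x : ι → ℝ)
    (hx : ∀ i ∈ s, 0 < x i) :
    (#s : ℝ) * Real.log #s + ∑ i ∈ s, Real.log (x i) ≤ #s * Real.log (∑ i ∈ s, x i) := by
  rcases s.eq_empty_or_nonempty with rfl | hs
  · simp
  have hc : (0 : ℝ) < #s := by exact_mod_cast hs.card_pos
  have hS : 0 < ∑ i ∈ s, x i := Finset.sum_pos hx hs
  have key : ∀ i ∈ s, Real.log (x i) ≤
      x i * (#s / ∑ j ∈ s, x j) - 1 + (Real.log (∑ j ∈ s, x j) - Real.log #s) := by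
    intro i hi
    have h := Real.log_le_sub_one_of_pos (mul_pos (hx i hi) (div_pos hc hS))
    rw [Real.log_mul (hx i hi).ne' (div_pos hc hS).ne', Real.log_div hc.ne' hS.ne'] at h
    linarith
  have h := Finset.sum_le_sum key
  rw [Finset.sum_add_distrib, Finset.sum_sub_distrib, ← Finset.sum_mul,
    mul_div_cancel₀ _ hS.ne'] at h
  simp only [Finset.sum_const, nsmul_eq_mul] at h
  linarith

/-- The tangent-line inequality at `b` for the function `y ↦ (y + 1) * log y`, which is convex on
`[1, ∞)`. -/
theorem tangent_le_add_one_mul_log {y b : ℝ} (hy : 1 ≤ y) (hb : 1 ≤ b) :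
    (y + 1) * Real.log b + (y - b) * ((b + 1) / b) ≤ (y + 1) * Real.log y := by
  have hb0 : 0 < b := by linarith
  obtain ⟨t, rfl⟩ : ∃ t, y = b * t := ⟨y / b, by field_simp⟩
  have ht : 0 < t := pos_of_mul_pos_right (by linarith) hb0.le
  have hlog : 0 ≤ t * Real.log t - t + 1 := by
    have h := mul_le_mul_of_nonneg_left (Real.one_sub_inv_le_log_of_pos ht) ht.le
    rw [mul_sub, mul_inv_cancel₀ ht.ne'] at h
    linarith
  have main : (t - 1) * (b + 1) ≤ (b * t + 1) * Real.log t := by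
    rcases le_total 1 t with h1 | h1
    · have h := Real.le_log_one_add_of_nonneg (sub_nonneg.2 h1)
      rw [div_le_iff₀ (by linarith), add_sub_cancel] at h
      nlinarith [mul_nonneg (sub_nonneg.2 hb) hlog]
    · have h : Real.sinh (Real.log t) ≤ Real.log t :=
        Real.sinh_le_self_iff.2 (Real.log_nonpos ht.le h1)
      rw [Real.sinh_log ht] at h
      have hbt : t⁻¹ ≤ b := (inv_le_iff_one_le_mul₀ ht).2 hy
      have h2 := mul_nonneg (sub_nonneg.2 hbt) hlog
      have h3 : t⁻¹ * (t * Real.log t - t + 1) = Real.log t - 1 + t⁻¹ := by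
        field_simp
      nlinarith
  rw [Real.log_mul hb0.ne' ht.ne']
  have : (b * t - b) * ((b + 1) / b) = (t - 1) * (b + 1) := by field_simp
  rw [this]
  linarith

namespace SimpleGraph

theorem card_dart_eq_sum_degree {V : Type*} [Fintype V] {G : SimpleGraph V}
    [DecidableRel G.Adj] : (Fintype.card G.Dart : ℝ) = ∑ v, (G.degree v : ℝ) := by
  rw [dart_card_eq_sum_degrees]
  push_cast
  rfl

theorem two_le_card_dart_div_card {V : Type*} [Fintype V] [Nonempty V] {G : SimpleGraph V}
    [DecidableRel G.Adj] (hdeg : ∀ v, 2 ≤ G.degree v) :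
    (2 : ℝ) ≤ Fintype.card G.Dart / Fintype.card V := by
  rw [le_div_iff₀ (by exact_mod_cast Fintype.card_pos), card_dart_eq_sum_degree, mul_comm,
    ← nsmul_eq_mul]
  exact card_nsmul_le_sum _ _ _ fun v _ => by exact_mod_cast hdeg v

variable {V : Type*} [Fintype V] [DecidableEq V] (G : SimpleGraph V) [DecidableRel G.Adj]

/-- The darts that may follow `e` in a non-backtracking walk. -/
def nbSucc (e : G.Dart) : Finset G.Dart :=
  univ.filter fun f => e.snd = f.fst ∧ f ≠ e.symm

/-- The number of non-backtracking walks of length `k + 1` with first dart `e`. -/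
def nbWalkCount (k : ℕ) (e : G.Dart) : ℕ :=
  #{w ∈ nbWalkSet G (k + 1) | w 0 = e}

theorem card_nbSucc (e : G.Dart) : #(G.nbSucc e) = G.degree e.snd - 1 := by
  have : G.nbSucc e = (univ.filter fun f : G.Dart => f.fst = e.snd).erase e.symm := by
    ext f
    simp only [nbSucc, mem_filter, mem_univ, true_and, mem_erase]
    tauto
  rw [this, card_erase_of_mem (by simp), dart_fst_fiber_card_eq_degree]

theorem card_filter_mem_nbSucc (f : G.Dart) :
    #{e | f ∈ G.nbSucc e} = G.degree f.fst - 1 := by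
  rw [← dart_fst_fiber_card_eq_degree, ← card_erase_of_mem (a := f) (by simp)]
  refine card_nbij' Dart.symm Dart.symm ?_ ?_ (fun _ _ => Dart.symm_symm _)
    (fun _ _ => Dart.symm_symm _)
  · intro e he
    simp_all [nbSucc, eq_comm]
  · intro e he
    simp_all [nbSucc, eq_comm]

theorem nbWalkCount_zero (e : G.Dart) : G.nbWalkCount 0 e = 1 := by
  rw [nbWalkCount, card_eq_one]
  refine ⟨fun _ => e, ?_⟩
  ext w
  simp only [nbWalkSet, mem_filter, mem_univ, true_and, mem_singleton, funext_iff]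
  constructor
  · rintro ⟨-, h⟩ i
    rwa [Fin.fin_one_eq_zero i]
  · intro h
    exact ⟨fun i j hij => by omega, h 0⟩

theorem sum_nbWalkCount (k : ℕ) : ∑ e, G.nbWalkCount k e = #(nbWalkSet G (k + 1)) :=
  (card_eq_sum_card_fiberwise fun _ _ => mem_univ _).symm

variable {G} in
theorem cons_mem_nbWalkSet {k : ℕ} {e : G.Dart} {w : Fin (k + 1) → G.Dart}
    (hw : w ∈ nbWalkSet G (k + 1)) (he : w 0 ∈ G.nbSucc e) :
    (Fin.cons e w : Fin (k + 2) → G.Dart) ∈ nbWalkSet G (k + 2) := by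
  simp only [nbWalkSet, nbSucc, mem_filter, mem_univ, true_and] at hw he ⊢
  intro i j hij
  obtain ⟨j, rfl⟩ := Fin.exists_succ_eq.2 (show j ≠ 0 by rintro rfl; simp at hij)
  induction i using Fin.cases with
  | zero =>
    obtain rfl : j = 0 := by ext; simpa using hij
    simpa using he
  | succ i => simpa using hw i j (by simpa using hij)

theorem sum_nbSucc_nbWalkCount_le (k : ℕ) (e : G.Dart) :
    ∑ f ∈ G.nbSucc e, G.nbWalkCount k f ≤ G.nbWalkCount (k + 1) e := by
  have h : ∑ f ∈ G.nbSucc e, G.nbWalkCount k f =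
      #{w ∈ nbWalkSet G (k + 1) | w 0 ∈ G.nbSucc e} := by
    rw [card_eq_sum_card_fiberwise (s := {w ∈ nbWalkSet G (k + 1) | w 0 ∈ G.nbSucc e})
      (f := fun w => w 0) (t := G.nbSucc e) fun w hw => (mem_filter.1 hw).2]
    refine sum_congr rfl fun f hf => congrArg card ?_
    ext w
    simp only [mem_filter]
    constructor
    · rintro ⟨hw, rfl⟩
      exact ⟨⟨hw, hf⟩, rfl⟩
    · rintro ⟨⟨hw, -⟩, h⟩
      exact ⟨hw, h⟩
  rw [h]
  refine card_le_card_of_injOn (fun w => Fin.cons e w) ?_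
    (Fin.cons_right_injective (α := fun _ => G.Dart) e).injOn
  intro w hw
  have hw := mem_filter.1 hw
  exact mem_filter.2 ⟨cons_mem_nbWalkSet hw.1 hw.2, rfl⟩

variable {G}

theorem nbWalkCount_pos (hdeg : ∀ v, 2 ≤ G.degree v) (k : ℕ) (e : G.Dart) :
    0 < G.nbWalkCount k e := by
  induction k generalizing e with
  | zero => simp [nbWalkCount_zero]
  | succ k ih =>
    refine (sum_pos (fun f _ => ih f) ?_).trans_le (G.sum_nbSucc_nbWalkCount_le k e)
    rw [← card_pos, card_nbSucc]
    have := hdeg e.snd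
    omega

theorem log_degree_add_average_le (hdeg : ∀ v, 2 ≤ G.degree v) (k : ℕ) (e : G.Dart) :
    Real.log (G.degree e.snd - 1) + ∑ f ∈ G.nbSucc e,
      ((G.degree f.fst : ℝ) - 1)⁻¹ * Real.log (G.nbWalkCount k f) ≤
      Real.log (G.nbWalkCount (k + 1) e) := by
  have hpos : ∀ f ∈ G.nbSucc e, (0 : ℝ) < G.nbWalkCount k f := fun f _ => by
    exact_mod_cast nbWalkCount_pos hdeg k f
  have hcard : (#(G.nbSucc e) : ℝ) = G.degree e.snd - 1 := by
    rw [card_nbSucc, Nat.cast_sub (by linarith [hdeg e.snd]), Nat.cast_one]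
  have hd : (2 : ℝ) ≤ G.degree e.snd := by exact_mod_cast hdeg e.snd
  have hq : (0 : ℝ) < G.degree e.snd - 1 := by linarith
  have hne : (G.nbSucc e).Nonempty := by
    rw [← card_pos]
    exact_mod_cast hcard ▸ hq
  have hsum : Real.log (∑ f ∈ G.nbSucc e, (G.nbWalkCount k f : ℝ)) ≤
      Real.log (G.nbWalkCount (k + 1) e) :=
    Real.log_le_log (sum_pos hpos hne) (by exact_mod_cast G.sum_nbSucc_nbWalkCount_le k e)
  have hJ := card_mul_log_card_add_sum_log_le (G.nbSucc e) _ hpos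
  rw [hcard] at hJ
  have hfst : ∑ f ∈ G.nbSucc e, ((G.degree f.fst : ℝ) - 1)⁻¹ * Real.log (G.nbWalkCount k f) =
      ((G.degree e.snd : ℝ) - 1)⁻¹ * ∑ f ∈ G.nbSucc e, Real.log (G.nbWalkCount k f) := by
    rw [mul_sum]
    refine sum_congr rfl fun f hf => ?_
    rw [(mem_filter.1 hf).2.1]
  rw [hfst]
  refine le_trans ?_ hsum
  refine le_of_mul_le_mul_left ?_ hq
  rwa [mul_add, mul_inv_cancel_left₀ hq.ne']

theorem sum_log_nbWalkCount_succ_le (hdeg : ∀ v, 2 ≤ G.degree v) (k : ℕ) :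
    ∑ e : G.Dart, Real.log (G.degree e.snd - 1) + ∑ e, Real.log (G.nbWalkCount k e) ≤
      ∑ e, Real.log (G.nbWalkCount (k + 1) e) := by
  have h := sum_le_sum fun e (_ : e ∈ univ) => log_degree_add_average_le hdeg k e
  rw [sum_add_distrib] at h
  refine le_of_eq_of_le (congrArg _ (Eq.symm ?_)) h
  rw [sum_comm' (t' := univ) (s' := fun f => univ.filter fun e => f ∈ G.nbSucc e) (by simp)]
  refine sum_congr rfl fun f _ => ?_
  have hd : (2 : ℝ) ≤ G.degree f.fst := by exact_mod_cast hdeg f.fst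
  rw [sum_const, card_filter_mem_nbSucc, nsmul_eq_mul,
    Nat.cast_sub (by linarith [hdeg f.fst]), Nat.cast_one,
    mul_inv_cancel_left₀ (by linarith)]

theorem mul_sum_log_degree_le (hdeg : ∀ v, 2 ≤ G.degree v) (k : ℕ) :
    k * ∑ e : G.Dart, Real.log (G.degree e.snd - 1) ≤ ∑ e, Real.log (G.nbWalkCount k e) := by
  induction k with
  | zero => simp [nbWalkCount_zero]
  | succ k ih =>
    push_cast
    linarith [sum_log_nbWalkCount_succ_le hdeg k]

theorem sum_dart_log_degree_snd :
    ∑ e : G.Dart, Real.log (G.degree e.snd - 1) =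
      ∑ v, G.degree v * Real.log (G.degree v - 1) := by
  rw [← Equiv.sum_comp (Dart.symm_involutive (G := G)).toPerm]
  change ∑ e : G.Dart, Real.log (G.degree e.fst - 1) = _
  rw [← sum_fiberwise univ (fun e : G.Dart => e.fst)]
  refine sum_congr rfl fun v _ => ?_
  rw [sum_congr rfl (g := fun _ => Real.log (G.degree v - 1))
    fun e he => by rw [(mem_filter.1 he).2], sum_const, dart_fst_fiber_card_eq_degree,
    nsmul_eq_mul]

/-- The average degree minus one is at most the geometric mean over darts of the degree minus
one. -/
theorem card_dart_mul_log_le [Nonempty V] (hdeg : ∀ v, 2 ≤ G.degree v) :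
    Fintype.card G.Dart * Real.log ((Fintype.card G.Dart : ℝ) / Fintype.card V - 1) ≤
      ∑ e : G.Dart, Real.log (G.degree e.snd - 1) := by
  have hD := two_le_card_dart_div_card hdeg
  have hn : (0 : ℝ) < Fintype.card V := by exact_mod_cast Fintype.card_pos
  have hm : (Fintype.card G.Dart : ℝ) / Fintype.card V * Fintype.card V = Fintype.card G.Dart :=
    div_mul_cancel₀ _ hn.ne'
  rw [sum_dart_log_degree_snd]
  set D := (Fintype.card G.Dart : ℝ) / Fintype.card V
  have h := sum_le_sum fun v (_ : v ∈ univ) => tangent_le_add_one_mul_log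
    (y := (G.degree v : ℝ) - 1) (b := D - 1)
    (by linarith [show (2 : ℝ) ≤ G.degree v by exact_mod_cast hdeg v]) (by linarith)
  simp only [sub_add_cancel, sub_sub_sub_cancel_right] at h
  rw [sum_add_distrib, ← sum_mul, ← sum_mul, sum_sub_distrib, ← card_dart_eq_sum_degree,
    sum_const, nsmul_eq_mul, card_univ, mul_comm _ D, hm] at h
  linarith

end SimpleGraph

/-- Moore bound combined with the geometric-mean vs average-degree comparison:
if every vertex of `G` has degree at least `2`, `m` is the number of darts,
`n` the number of vertices and `d̄ = m/n` the average degree, then the number of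
non-backtracking walks of length `l ≥ 1` is at least `m * (d̄ - 1) ^ (l - 1)`. -/
theorem moore_bound_average_degree {V : Type*} [Fintype V] [DecidableEq V]
    (G : SimpleGraph V) [DecidableRel G.Adj]
    (hdeg : ∀ v : V, 2 ≤ G.degree v) (l : ℕ) (hl : 1 ≤ l) :
    (Fintype.card G.Dart : ℝ) *
      ((Fintype.card G.Dart : ℝ) / (Fintype.card V : ℝ) - 1) ^ (l - 1) ≤
      ((nbWalkSet G l).card : ℝ) := by
  obtain ⟨k, rfl⟩ := Nat.exists_eq_add_of_le' hl
  rw [Nat.add_sub_cancel]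
  rcases isEmpty_or_nonempty G.Dart with hE | ⟨⟨e⟩⟩
  · simp
  have : Nonempty V := ⟨e.fst⟩
  have hm : (0 : ℝ) < Fintype.card G.Dart := by exact_mod_cast Fintype.card_pos_iff.2 ⟨e⟩
  have hD : (0 : ℝ) < (Fintype.card G.Dart : ℝ) / Fintype.card V - 1 := by
    linarith [two_le_card_dart_div_card hdeg]
  have hpos : ∀ f ∈ univ, (0 : ℝ) < G.nbWalkCount k f := fun f _ => by
    exact_mod_cast nbWalkCount_pos hdeg k f
  have hJ := card_mul_log_card_add_sum_log_le univ _ hpos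
  have hM : ∑ f, (G.nbWalkCount k f : ℝ) = #(nbWalkSet G (k + 1)) := by
    exact_mod_cast G.sum_nbWalkCount k
  have hMpos := sum_pos hpos ⟨e, mem_univ e⟩
  rw [hM] at hJ hMpos
  rw [← Real.log_le_log_iff (mul_pos hm (pow_pos hD k)) hMpos,
    Real.log_mul hm.ne' (pow_pos hD k).ne', Real.log_pow]
  refine le_of_mul_le_mul_left ?_ hm
  have h₁ := mul_sum_log_degree_le hdeg k
  have h₂ := mul_le_mul_of_nonneg_left (card_dart_mul_log_le hdeg) (Nat.cast_nonneg (α := ℝ) k)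
  rw [card_univ] at hJ
  linarith
end
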